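/- Let A ⊆ Hom_K(F, K̄) satisfy A ∩ Ā = ∅, set A₀ := {φ|_{F₀} : φ ∈ A} ⊆ Hom_K(F₀, K̄), and let E be a finite extension of K inside K̄ containing E_A (which contains the reflex field E_{A₀}). Then A ⊔ Ā is the preimage of A₀ under the restriction map Hom_K(F, K̄) → Hom_K(F₀, K̄), and in O_F ⊗_{O_K} O_E one has the equality of ideals J_A · J_{Ā} = J_{A₀} · (O_F ⊗_{O_K} O_E), where J_{A₀} ⊆ O_{F₀} ⊗_{O_K} O_E is the Eisenstein ideal of A₀ formed for the extension F₀/K and acts on O_F ⊗_{O_K} O_E via the natural map O_{F₀} ⊗_{O_K} O_E → O_F ⊗_{O_K} O_E. -/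

import Mathlib

open scoped TensorProduct Polynomial

set_option synthInstance.maxHeartbeats 400000
set_option maxHeartbeats 1000000

noncomputable section

variable (p : ℕ) [Fact p.Prime]

/-- The ring of integers of a `p`-adic field `L`: the integral closure of `ℤₚ` in `L`. -/
def RInt (L : Type) [Field L] [Algebra ℤ_[p] L] : Type := ↥(integralClosure ℤ_[p] L)

local instance instCR (L : Type) [Field L] [Algebra ℤ_[p] L] : CommRing (RInt p L) :=
  inferInstanceAs (CommRing ↥(integralClosure ℤ_[p] L))

local instance instAlgL (L : Type) [Field L] [Algebra ℤ_[p] L] : Algebra (RInt p L) L :=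
  inferInstanceAs (Algebra ↥(integralClosure ℤ_[p] L) L)

/-- Functoriality of rings of integers. -/
def RIntMap (L L' : Type) [Field L] [Field L'] [Algebra ℤ_[p] L] [Algebra ℤ_[p] L']
    (f : L →ₐ[ℤ_[p]] L') : RInt p L →+* RInt p L' :=
  show ↥(integralClosure ℤ_[p] L) →+* ↥(integralClosure ℤ_[p] L') from
  { toFun := fun x => ⟨f x, IsIntegral.map f x.2⟩
    map_one' := by ext; simp
    map_mul' := fun x y => by ext; simp
    map_zero' := by ext; simp
    map_add' := fun x y => by ext; simp }

section Galois

variable (K F : Type) [Field K] [Field F] [Algebra K F]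

/-- The stabilizer of a finite set of embeddings `F →ₐ[K] K̄` inside `Gal(K̄/K)`:
the set of `σ` with `σ ∘ S = S`. -/
def galStab (S : Finset (F →ₐ[K] AlgebraicClosure K)) :
    Subgroup (AlgebraicClosure K ≃ₐ[K] AlgebraicClosure K) := by
  letI := Classical.decEq (F →ₐ[K] AlgebraicClosure K)
  exact
  { carrier := {σ | S.image (fun φ =>
        ((σ : AlgebraicClosure K →ₐ[K] AlgebraicClosure K)).comp φ) = S}
    one_mem' := by
      have h : (fun φ : F →ₐ[K] AlgebraicClosure K =>
          (((1 : AlgebraicClosure K ≃ₐ[K] AlgebraicClosure K) :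
            AlgebraicClosure K →ₐ[K] AlgebraicClosure K)).comp φ) = id := by
        funext φ; exact AlgHom.ext fun x => rfl
      simp only [Set.mem_setOf_eq, h, Finset.image_id]
    mul_mem' := by
      intro σ τ hσ hτ
      simp only [Set.mem_setOf_eq] at hσ hτ ⊢
      have h : (fun φ : F →ₐ[K] AlgebraicClosure K =>
          (((σ * τ : AlgebraicClosure K ≃ₐ[K] AlgebraicClosure K) :
            AlgebraicClosure K →ₐ[K] AlgebraicClosure K)).comp φ)
          = (fun φ => ((σ : AlgebraicClosure K →ₐ[K] AlgebraicClosure K)).comp φ) ∘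
            (fun φ => ((τ : AlgebraicClosure K →ₐ[K] AlgebraicClosure K)).comp φ) := by
        funext φ; exact AlgHom.ext fun x => rfl
      rw [h, ← Finset.image_image, hτ, hσ]
    inv_mem' := by
      intro σ hσ
      simp only [Set.mem_setOf_eq] at hσ ⊢
      conv_lhs => rw [← hσ]
      rw [Finset.image_image]
      have h : ((fun φ : F →ₐ[K] AlgebraicClosure K =>
          (((σ⁻¹ : AlgebraicClosure K ≃ₐ[K] AlgebraicClosure K) :
            AlgebraicClosure K →ₐ[K] AlgebraicClosure K)).comp φ) ∘
          (fun φ => ((σ : AlgebraicClosure K →ₐ[K] AlgebraicClosure K)).comp φ)) = id := by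
        funext φ
        exact AlgHom.ext fun x => σ.symm_apply_apply (φ x)
      rw [h, Finset.image_id] }

/-- The reflex field `E_S ⊆ K̄` of a set `S` of embeddings `F →ₐ[K] K̄`: the fixed field
of its stabilizer in `Gal(K̄/K)`. -/
def reflexField (S : Finset (F →ₐ[K] AlgebraicClosure K)) :
    IntermediateField K (AlgebraicClosure K) :=
  IntermediateField.fixedField (galStab K F S)

end Galois

section Eis

/- `K` is a finite extension of `ℚₚ` (with its induced `ℤₚ`-algebra structure), `F` is a
finite extension of `K`, and `E` is a further finite extension of `K` equipped with a
`K`-embedding `ιE : E → K̄` realizing it as a subfield of an algebraic closure of `K`. -/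
variable (K : Type) [Field K] [Algebra ℚ_[p] K] [FiniteDimensional ℚ_[p] K]
  [Algebra ℤ_[p] K] [IsScalarTower ℤ_[p] ℚ_[p] K]
variable (F : Type) [Field F] [Algebra K F] [FiniteDimensional K F]
  [Algebra ℤ_[p] F] [IsScalarTower ℤ_[p] K F]
variable (E : Type) [Field E] [Algebra K E] [Algebra ℤ_[p] E] [IsScalarTower ℤ_[p] K E]

local instance algOKOF : Algebra (RInt p K) (RInt p F) :=
  (RIntMap p K F (IsScalarTower.toAlgHom ℤ_[p] K F)).toAlgebra

local instance algOKOE : Algebra (RInt p K) (RInt p E) :=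
  (RIntMap p K E (IsScalarTower.toAlgHom ℤ_[p] K E)).toAlgebra

variable (ιE : E →ₐ[K] AlgebraicClosure K)

/-- The canonical map `O_E → K̄` induced by `ιE : E → K̄`. -/
def OEtoKb : RInt p E →+* AlgebraicClosure K :=
  (ιE : E →+* AlgebraicClosure K).comp (algebraMap (RInt p E) E)

/-- `Q ∈ O_E[T]` represents the Eisenstein polynomial `e_{ζ,S}(T) = ∏_{φ ∈ S} (T - φ(ζ))`. -/
def IsEisPoly (S : Finset (F →ₐ[K] AlgebraicClosure K)) (ζ : RInt p F)
    (Q : Polynomial (RInt p E)) : Prop :=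
  Q.map (OEtoKb p K E ιE) =
    ∏ φ ∈ S, (Polynomial.X - Polynomial.C (φ (algebraMap (RInt p F) F ζ)))

variable (R : Type) [CommRing R] [Algebra (RInt p K) R] [Algebra (RInt p E) R]

/-- The element `e_S = e_{ζ,S}(ζ ⊗ 1)` of `O_F ⊗_{O_K} R`, where `Q ∈ O_E[T]`
represents the Eisenstein polynomial `e_{ζ,S}(T)`. -/
def eElt (Q : Polynomial (RInt p E)) (ζ : RInt p F) : (RInt p F) ⊗[RInt p K] R :=
  Polynomial.eval₂
    ((Algebra.TensorProduct.includeRight :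
        R →ₐ[RInt p K] (RInt p F) ⊗[RInt p K] R).toRingHom.comp (algebraMap (RInt p E) R))
    (ζ ⊗ₜ[RInt p K] (1 : R)) Q

/-- The Eisenstein ideal `J_{S,R} ⊆ O_F ⊗_{O_K} R`, generated by `e_S`. -/
def JIdeal (Q : Polynomial (RInt p E)) (ζ : RInt p F) :
    Ideal ((RInt p F) ⊗[RInt p K] R) :=
  Ideal.span {eElt p K F E R Q ζ}

local instance algOKKb : Algebra (RInt p K) (AlgebraicClosure K) :=
  ((algebraMap K (AlgebraicClosure K)).comp (algebraMap (RInt p K) K)).toAlgebra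

/-- The restriction of an embedding `φ : F →ₐ[K] K̄` to the ring of integers, as an
`O_K`-algebra homomorphism `O_F →ₐ[O_K] K̄`. -/
def embToKb (φ : F →ₐ[K] AlgebraicClosure K) : RInt p F →ₐ[RInt p K] AlgebraicClosure K where
  toRingHom := (φ : F →+* AlgebraicClosure K).comp (algebraMap (RInt p F) F)
  commutes' := fun r => by
    have h1 : (algebraMap (RInt p F) F) ((algebraMap (RInt p K) (RInt p F)) r)
        = algebraMap K F ((algebraMap (RInt p K) K) r) := by
      show algebraMap K F ((IsScalarTower.toAlgHom ℤ_[p] K K) ((algebraMap (RInt p K) K) r)) = _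
      rfl
    show φ ((algebraMap (RInt p F) F) ((algebraMap (RInt p K) (RInt p F)) r)) = _
    rw [h1, φ.commutes]
    rfl

/-- The inclusion `O_E → K̄` as an `O_K`-algebra homomorphism. -/
def oEToKb : RInt p E →ₐ[RInt p K] AlgebraicClosure K where
  toRingHom := OEtoKb p K E ιE
  commutes' := fun r => by
    have h1 : (algebraMap (RInt p E) E) ((algebraMap (RInt p K) (RInt p E)) r)
        = algebraMap K E ((algebraMap (RInt p K) K) r) := by
      show algebraMap K E ((IsScalarTower.toAlgHom ℤ_[p] K K) ((algebraMap (RInt p K) K) r)) = _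
      rfl
    show ιE ((algebraMap (RInt p E) E) ((algebraMap (RInt p K) (RInt p E)) r)) = _
    rw [h1, ιE.commutes]
    rfl

/-- The map `O_F ⊗_{O_K} O_E → K̄` whose value on `a ⊗ e` is `φ(a)·e`. -/
def phiComponent (φ : F →ₐ[K] AlgebraicClosure K) :
    (RInt p F) ⊗[RInt p K] (RInt p E) →ₐ[RInt p K] AlgebraicClosure K :=
  Algebra.TensorProduct.productMap (embToKb p K F φ) (oEToKb p K E ιE)

variable (F₀ : Type) [Field F₀] [Algebra K F₀] [FiniteDimensional K F₀]
  [Algebra ℤ_[p] F₀] [IsScalarTower ℤ_[p] K F₀]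
  [Algebra F₀ F] [IsScalarTower K F₀ F]

/-- The inclusion `O_{F₀} → O_F` as an `O_K`-algebra homomorphism. -/
def inclO : RInt p F₀ →ₐ[RInt p K] RInt p F where
  toRingHom := RIntMap p F₀ F ((IsScalarTower.toAlgHom K F₀ F).restrictScalars ℤ_[p])
  commutes' := fun r => by
    apply Subtype.ext
    show algebraMap F₀ F ((algebraMap K F₀) ((algebraMap (RInt p K) K) r)) = _
    rw [← IsScalarTower.algebraMap_apply K F₀ F]
    rfl

theorem aux_mult (x : F) : ∃ y : K, y ≠ 0 ∧ IsIntegral ℤ_[p] (algebraMap K F y * x) := by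
  have h1 : Algebra.IsAlgebraic ℤ_[p] K :=
    (IsFractionRing.comap_isAlgebraic_iff (A := ℤ_[p]) (K := ℚ_[p]) (C := K)).2 inferInstance
  have hinj : Function.Injective (algebraMap ℤ_[p] K) := by
    rw [IsScalarTower.algebraMap_eq ℤ_[p] ℚ_[p] K]
    exact (algebraMap ℚ_[p] K).injective.comp (IsFractionRing.injective ℤ_[p] ℚ_[p])
  have : FaithfulSMul ℤ_[p] K := (faithfulSMul_iff_algebraMap_injective _ _).2 hinj
  have h2 : Algebra.IsAlgebraic ℤ_[p] F := Algebra.IsAlgebraic.trans ℤ_[p] K F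
  obtain ⟨y, hy, h⟩ := (h2.isAlgebraic x).exists_integral_multiple
  refine ⟨algebraMap ℤ_[p] K y, ?_, ?_⟩
  · intro h0
    exact hy (hinj (by rw [h0, map_zero]))
  · rw [← IsScalarTower.algebraMap_apply, ← Algebra.smul_def]
    exact h

theorem aux_ext (ζ : RInt p F) (hζ : Algebra.adjoin (RInt p K) {ζ} = ⊤)
    (φ ψ : F →ₐ[K] AlgebraicClosure K)
    (h : φ (algebraMap (RInt p F) F ζ) = ψ (algebraMap (RInt p F) F ζ)) : φ = ψ := by
  have h1 : embToKb p K F φ = embToKb p K F ψ := by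
    apply AlgHom.ext_of_adjoin_eq_top hζ
    intro x hx
    obtain rfl : x = ζ := hx
    exact h
  ext x
  obtain ⟨y, hy, hx⟩ := aux_mult p K F x
  have h2 : φ (algebraMap K F y * x) = ψ (algebraMap K F y * x) :=
    DFunLike.congr_fun h1 (⟨_, hx⟩ : ↥(integralClosure ℤ_[p] F))
  rw [map_mul, map_mul, φ.commutes, ψ.commutes] at h2
  exact mul_left_cancel₀ (by simpa using hy) h2

theorem aux_comp_eElt (φ : F →ₐ[K] AlgebraicClosure K) (f : Polynomial (RInt p E))
    (ζ : RInt p F) :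
    phiComponent p K F E ιE φ (eElt p K F E (RInt p E) f ζ) =
      (f.map (OEtoKb p K E ιE)).eval (φ (algebraMap (RInt p F) F ζ)) := by
  have h1 : phiComponent p K F E ιE φ (ζ ⊗ₜ[RInt p K] (1 : RInt p E))
      = φ (algebraMap (RInt p F) F ζ) := by
    rw [phiComponent, Algebra.TensorProduct.productMap_apply_tmul, map_one, mul_one]
    rfl
  rw [Polynomial.eval_map, ← h1, eElt]
  have := Polynomial.hom_eval₂ f ((Algebra.TensorProduct.includeRight :
        RInt p E →ₐ[RInt p K] (RInt p F) ⊗[RInt p K] RInt p E).toRingHom.comp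
          (algebraMap (RInt p E) (RInt p E)))
        (phiComponent p K F E ιE φ).toRingHom (ζ ⊗ₜ[RInt p K] (1 : RInt p E))
  refine this.trans ?_
  congr 1
  ext e
  show phiComponent p K F E ιE φ ((1 : RInt p F) ⊗ₜ[RInt p K] e) = _
  rw [phiComponent, Algebra.TensorProduct.productMap_apply_tmul, map_one, one_mul]
  rfl

theorem aux_eElt_mul (f g : Polynomial (RInt p E)) (ζ : RInt p F) :
    eElt p K F E (RInt p E) (f * g) ζ =
      eElt p K F E (RInt p E) f ζ * eElt p K F E (RInt p E) g ζ :=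
  Polynomial.eval₂_mul _ _

theorem aux_eElt_add (f g : Polynomial (RInt p E)) (ζ : RInt p F) :
    eElt p K F E (RInt p E) (f + g) ζ =
      eElt p K F E (RInt p E) f ζ + eElt p K F E (RInt p E) g ζ :=
  Polynomial.eval₂_add _ _

theorem aux_eElt_C (e : RInt p E) (ζ : RInt p F) :
    eElt p K F E (RInt p E) (Polynomial.C e) ζ = (1 : RInt p F) ⊗ₜ[RInt p K] e :=
  Polynomial.eval₂_C _ _

theorem aux_eElt_X (ζ : RInt p F) :
    eElt p K F E (RInt p E) Polynomial.X ζ = ζ ⊗ₜ[RInt p K] (1 : RInt p E) :=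
  Polynomial.eval₂_X _ _

theorem aux_surj (ζ : RInt p F) (hζ : Algebra.adjoin (RInt p K) {ζ} = ⊤)
    (x : (RInt p F) ⊗[RInt p K] (RInt p E)) :
    ∃ f : Polynomial (RInt p E), eElt p K F E (RInt p E) f ζ = x := by
  have key : ∀ a : RInt p F, ∃ f : Polynomial (RInt p E),
      eElt p K F E (RInt p E) f ζ = a ⊗ₜ[RInt p K] (1 : RInt p E) := by
    intro a
    have ha : a ∈ Algebra.adjoin (RInt p K) {ζ} := by rw [hζ]; trivial
    induction ha using Algebra.adjoin_induction with
    | mem x hx =>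
      obtain rfl : x = ζ := hx
      exact ⟨_, aux_eElt_X p K F E x⟩
    | algebraMap r =>
      refine ⟨Polynomial.C (algebraMap _ _ r), ?_⟩
      rw [aux_eElt_C, Algebra.algebraMap_eq_smul_one, Algebra.algebraMap_eq_smul_one,
        TensorProduct.tmul_smul, TensorProduct.smul_tmul']
    | add x y _ _ hx hy =>
      obtain ⟨f, hf⟩ := hx
      obtain ⟨g, hg⟩ := hy
      exact ⟨f + g, by rw [aux_eElt_add, hf, hg, TensorProduct.add_tmul]⟩
    | mul x y _ _ hx hy =>
      obtain ⟨f, hf⟩ := hx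
      obtain ⟨g, hg⟩ := hy
      exact ⟨f * g, by
        rw [aux_eElt_mul, hf, hg, Algebra.TensorProduct.tmul_mul_tmul, one_mul]⟩
  induction x using TensorProduct.induction_on with
  | zero => exact ⟨0, Polynomial.eval₂_zero _ _⟩
  | tmul a e =>
    obtain ⟨f, hf⟩ := key a
    exact ⟨f * Polynomial.C e, by
      rw [aux_eElt_mul, hf, aux_eElt_C, Algebra.TensorProduct.tmul_mul_tmul, one_mul, mul_one]⟩
  | add x y hx hy =>
    obtain ⟨f, hf⟩ := hx
    obtain ⟨g, hg⟩ := hy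
    exact ⟨f + g, by rw [aux_eElt_add, hf, hg]⟩

theorem aux_OE_inj : Function.Injective (OEtoKb p K E ιE) := by
  intro a b h
  exact Subtype.ext (ιE.injective h)

/-- The Eisenstein ideal is the common kernel of the components `φ ∈ S`. -/
theorem aux_mem_J (S : Finset (F →ₐ[K] AlgebraicClosure K)) (ζ : RInt p F)
    (hζ : Algebra.adjoin (RInt p K) {ζ} = ⊤) (Q : Polynomial (RInt p E))
    (hQ : IsEisPoly p K F E ιE S ζ Q) (x : (RInt p F) ⊗[RInt p K] (RInt p E)) :
    x ∈ JIdeal p K F E (RInt p E) Q ζ ↔ ∀ φ ∈ S, phiComponent p K F E ιE φ x = 0 := by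
  have hroot : ∀ φ ∈ S, phiComponent p K F E ιE φ (eElt p K F E (RInt p E) Q ζ) = 0 := by
    intro φ hφ
    rw [aux_comp_eElt, hQ, Polynomial.eval_prod]
    exact Finset.prod_eq_zero hφ (by simp)
  rw [JIdeal, Ideal.mem_span_singleton]
  constructor
  · rintro ⟨y, rfl⟩ φ hφ
    rw [map_mul, hroot φ hφ, zero_mul]
  · intro h
    have hinj := aux_OE_inj p K E ιE
    have hmonic : Q.Monic := by
      apply Polynomial.monic_of_injective hinj
      rw [hQ]
      exact Polynomial.monic_prod_of_monic _ _ fun φ _ => Polynomial.monic_X_sub_C _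
    obtain ⟨f, rfl⟩ := aux_surj p K F E ζ hζ x
    have hr : f %ₘ Q = 0 := by
      have hdvd : (Q.map (OEtoKb p K E ιE)) ∣ (f %ₘ Q).map (OEtoKb p K E ιE) := by
        rw [hQ]
        apply Finset.prod_dvd_of_coprime
        · intro φ _ ψ _ hne
          apply Polynomial.pairwise_coprime_X_sub_C (fun φ ψ hh => aux_ext p K F ζ hζ φ ψ hh) hne
        · intro φ hφ
          rw [Polynomial.dvd_iff_isRoot, Polynomial.IsRoot, ← aux_comp_eElt]
          have h3 := h φ hφ
          rw [← Polynomial.modByMonic_add_div f Q, aux_eElt_add, aux_eElt_mul, map_add, map_mul,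
            hroot φ hφ, zero_mul, add_zero] at h3
          exact h3
      have hz : (f %ₘ Q).map (OEtoKb p K E ιE) = 0 := by
        apply Polynomial.eq_zero_of_dvd_of_degree_lt hdvd
        rw [Polynomial.degree_map_eq_of_injective hinj, Polynomial.degree_map_eq_of_injective hinj]
        have : Nontrivial (RInt p E) := inferInstanceAs (Nontrivial ↥(integralClosure ℤ_[p] E))
        exact Polynomial.degree_modByMonic_lt _ hmonic
      exact (Polynomial.map_eq_zero_iff hinj).1 hz
    refine ⟨eElt p K F E (RInt p E) (f /ₘ Q) ζ, ?_⟩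
    rw [← aux_eElt_mul]
    conv_lhs => rw [← Polynomial.modByMonic_add_div f Q, hr, zero_add]

theorem aux_lift (τ : F ≃ₐ[K] F)
    (hτfix' : ∀ y : F, τ y = y → ∃ x : F₀, algebraMap F₀ F x = y)
    (y : F) (hy : IsIntegral ℤ_[p] y) (hfix : τ y = y) :
    ∃ a : RInt p F₀, algebraMap (RInt p F) F (inclO p K F F₀ a) = y := by
  obtain ⟨x, rfl⟩ := hτfix' y hfix
  have hx : IsIntegral ℤ_[p] x :=
    (isIntegral_algHom_iff ((IsScalarTower.toAlgHom K F₀ F).restrictScalars ℤ_[p])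
      (algebraMap F₀ F).injective).1 hy
  exact ⟨(⟨x, hx⟩ : ↥(integralClosure ℤ_[p] F₀)), rfl⟩

theorem aux_quad (τ : F ≃ₐ[K] F) (hτ2 : ∀ x : F, τ (τ x) = x)
    (hτfix' : ∀ y : F, τ y = y → ∃ x : F₀, algebraMap F₀ F x = y) (ζ : RInt p F) :
    ∃ t n : RInt p F₀, ζ * ζ = inclO p K F F₀ n + ζ * inclO p K F F₀ t := by
  have h1 : IsIntegral ℤ_[p] (algebraMap (RInt p F) F ζ) := ζ.2
  have h2 : IsIntegral ℤ_[p] (τ (algebraMap (RInt p F) F ζ)) :=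
    h1.map ((τ : F →ₐ[K] F).restrictScalars ℤ_[p])
  obtain ⟨t, ht⟩ := aux_lift p K F F₀ τ hτfix' _ (h1.add h2) (by rw [map_add, hτ2, add_comm])
  obtain ⟨n, hn⟩ := aux_lift p K F F₀ τ hτfix' _ (h1.mul h2) (by rw [map_mul, hτ2, mul_comm])
  refine ⟨t, -n, ?_⟩
  have hinj : Function.Injective (algebraMap (RInt p F) F) := fun a b h => Subtype.ext h
  apply hinj
  rw [map_neg, map_add, map_neg, map_mul, map_mul, ht, hn]
  ring

theorem aux_gen (τ : F ≃ₐ[K] F) (hτ2 : ∀ x : F, τ (τ x) = x)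
    (hτfix' : ∀ y : F, τ y = y → ∃ x : F₀, algebraMap F₀ F x = y)
    (ζ : RInt p F) (hζ : Algebra.adjoin (RInt p K) {ζ} = ⊤) (o : RInt p F) :
    ∃ a b : RInt p F₀, o = inclO p K F F₀ a + ζ * inclO p K F F₀ b := by
  obtain ⟨t, n, htn⟩ := aux_quad p K F F₀ τ hτ2 hτfix' ζ
  have ho : o ∈ Algebra.adjoin (RInt p K) {ζ} := by rw [hζ]; trivial
  induction ho using Algebra.adjoin_induction with
  | mem x hx =>
    obtain rfl : x = ζ := hx
    exact ⟨0, 1, by rw [map_zero, map_one]; ring⟩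
  | algebraMap r => exact ⟨algebraMap _ _ r, 0, by rw [AlgHom.commutes, map_zero]; ring⟩
  | add x y _ _ hx hy =>
    obtain ⟨a, b, rfl⟩ := hx
    obtain ⟨c, d, rfl⟩ := hy
    exact ⟨a + c, b + d, by rw [map_add, map_add]; ring⟩
  | mul x y _ _ hx hy =>
    obtain ⟨a, b, rfl⟩ := hx
    obtain ⟨c, d, rfl⟩ := hy
    refine ⟨a * c + b * d * n, a * d + b * c + b * d * t, ?_⟩
    simp only [map_add, map_mul]
    linear_combination (inclO p K F F₀ b * inclO p K F F₀ d) * htn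

theorem aux_gen_tensor (τ : F ≃ₐ[K] F) (hτ2 : ∀ x : F, τ (τ x) = x)
    (hτfix' : ∀ y : F, τ y = y → ∃ x : F₀, algebraMap F₀ F x = y)
    (ζ : RInt p F) (hζ : Algebra.adjoin (RInt p K) {ζ} = ⊤)
    (x : (RInt p F) ⊗[RInt p K] (RInt p E)) :
    ∃ a b : (RInt p F₀) ⊗[RInt p K] (RInt p E),
      x = Algebra.TensorProduct.map (inclO p K F F₀) (AlgHom.id (RInt p K) (RInt p E)) a +
        (ζ ⊗ₜ[RInt p K] (1 : RInt p E)) *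
        Algebra.TensorProduct.map (inclO p K F F₀) (AlgHom.id (RInt p K) (RInt p E)) b := by
  induction x using TensorProduct.induction_on with
  | zero => exact ⟨0, 0, by rw [map_zero, mul_zero, add_zero]⟩
  | tmul o e =>
    obtain ⟨a, b, rfl⟩ := aux_gen p K F F₀ τ hτ2 hτfix' ζ hζ o
    refine ⟨a ⊗ₜ e, b ⊗ₜ e, ?_⟩
    rw [Algebra.TensorProduct.map_tmul, Algebra.TensorProduct.map_tmul,
      Algebra.TensorProduct.tmul_mul_tmul, one_mul, TensorProduct.add_tmul]
    rfl
  | add x y hx hy =>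
    obtain ⟨a, b, rfl⟩ := hx
    obtain ⟨c, d, rfl⟩ := hy
    refine ⟨a + c, b + d, ?_⟩
    rw [map_add, map_add]
    ring

theorem aux_comp_map (φ : F →ₐ[K] AlgebraicClosure K)
    (a : (RInt p F₀) ⊗[RInt p K] (RInt p E)) :
    phiComponent p K F E ιE φ
      (Algebra.TensorProduct.map (inclO p K F F₀) (AlgHom.id (RInt p K) (RInt p E)) a) =
    phiComponent p K F₀ E ιE (φ.comp (IsScalarTower.toAlgHom K F₀ F)) a := by
  induction a using TensorProduct.induction_on with
  | zero => simp only [map_zero]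
  | tmul o e =>
    rw [Algebra.TensorProduct.map_tmul, phiComponent, phiComponent,
      Algebra.TensorProduct.productMap_apply_tmul, Algebra.TensorProduct.productMap_apply_tmul]
    rfl
  | add x y hx hy => simp only [map_add, hx, hy]


/-- Lemma 2.13 and equation (2.17) of the paper. Let `τ` be the
nontrivial automorphism of the quadratic extension `F/F₀` and let `A ⊆ Hom_K(F, K̄)`
satisfy `A ∩ Ā = ∅`.  Set `A₀ := {φ|_{F₀} : φ ∈ A}` and let `E ⊇ E_A`.  Then `A ⊔ Ā` is
the preimage of `A₀` under the restriction map, and in `O_F ⊗_{O_K} O_E` one has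
`J_A · J_Ā = J_{A₀} · (O_F ⊗_{O_K} O_E)`. -/
theorem statement10 [FiniteDimensional K E] [DecidableEq (F →ₐ[K] AlgebraicClosure K)]
    [DecidableEq (F₀ →ₐ[K] AlgebraicClosure K)]
    (τ : F ≃ₐ[K] F) (hτ2 : ∀ x : F, τ (τ x) = x) (hτne : τ ≠ AlgEquiv.refl)
    (hτfix : ∀ x : F₀, τ (algebraMap F₀ F x) = algebraMap F₀ F x)
    (hτfix' : ∀ y : F, τ y = y → ∃ x : F₀, algebraMap F₀ F x = y)
    (A : Finset (F →ₐ[K] AlgebraicClosure K))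
    (hdisj : ∀ φ ∈ A, φ.comp (τ : F →ₐ[K] F) ∉ A)
    (hE : reflexField K F A ≤ ιE.fieldRange)
    (ζ : RInt p F) (hζ : Algebra.adjoin (RInt p K) {ζ} = ⊤)
    (ζ₀ : RInt p F₀) (hζ₀ : Algebra.adjoin (RInt p K) {ζ₀} = ⊤)
    (QA QAbar : Polynomial (RInt p E))
    (hQA : IsEisPoly p K F E ιE A ζ QA)
    (hQAbar : IsEisPoly p K F E ιE (A.image (fun φ => φ.comp (τ : F →ₐ[K] F))) ζ QAbar)
    (Q₀ : Polynomial (RInt p E))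
    (hQ₀ : IsEisPoly p K F₀ E ιE
      (A.image (fun φ => φ.comp (IsScalarTower.toAlgHom K F₀ F))) ζ₀ Q₀) :
    (∀ φ : F →ₐ[K] AlgebraicClosure K,
      (φ ∈ A ∪ A.image (fun φ' => φ'.comp (τ : F →ₐ[K] F)) ↔
        φ.comp (IsScalarTower.toAlgHom K F₀ F) ∈
          A.image (fun φ' => φ'.comp (IsScalarTower.toAlgHom K F₀ F)))) ∧
    JIdeal p K F E (RInt p E) QA ζ * JIdeal p K F E (RInt p E) QAbar ζ =
      Ideal.map
        (Algebra.TensorProduct.map (inclO p K F F₀) (AlgHom.id (RInt p K) (RInt p E)))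
        (JIdeal p K F₀ E (RInt p E) Q₀ ζ₀) := by
  have hres : ∀ φ : F →ₐ[K] AlgebraicClosure K,
      (φ.comp (τ : F →ₐ[K] F)).comp (IsScalarTower.toAlgHom K F₀ F) =
        φ.comp (IsScalarTower.toAlgHom K F₀ F) := by
    intro φ
    ext x
    exact congrArg φ (hτfix x)
  have hττ : ∀ φ : F →ₐ[K] AlgebraicClosure K,
      (φ.comp (τ : F →ₐ[K] F)).comp (τ : F →ₐ[K] F) = φ := by
    intro φ
    ext x
    exact congrArg φ (hτ2 x)
  have hpre : ∀ φ : F →ₐ[K] AlgebraicClosure K,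
      (φ ∈ A ∪ A.image (fun φ' => φ'.comp (τ : F →ₐ[K] F)) ↔
        φ.comp (IsScalarTower.toAlgHom K F₀ F) ∈
          A.image (fun φ' => φ'.comp (IsScalarTower.toAlgHom K F₀ F))) := by
    intro φ
    rw [Finset.mem_union, Finset.mem_image, Finset.mem_image]
    constructor
    · rintro (h | ⟨ψ, h, rfl⟩)
      · exact ⟨φ, h, rfl⟩
      · exact ⟨ψ, h, (hres ψ).symm⟩
    · rintro ⟨ψ, hψ, h⟩
      obtain ⟨t, n, htn⟩ := aux_quad p K F F₀ τ hτ2 hτfix' ζ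
      have hφψ : ∀ a : RInt p F₀, φ (algebraMap (RInt p F) F (inclO p K F F₀ a)) =
          ψ (algebraMap (RInt p F) F (inclO p K F F₀ a)) := fun a =>
        (DFunLike.congr_fun h (algebraMap (RInt p F₀) F₀ a)).symm
      have hψτ : ∀ a : RInt p F₀, ψ (τ (algebraMap (RInt p F) F (inclO p K F F₀ a))) =
          ψ (algebraMap (RInt p F) F (inclO p K F F₀ a)) := fun a =>
        DFunLike.congr_fun (hres ψ) (algebraMap (RInt p F₀) F₀ a)
      have e0 := congrArg (algebraMap (RInt p F) F) htn
      rw [map_mul, map_add, map_mul] at e0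
      have e1 := congrArg φ e0
      have e2 := congrArg ψ e0
      have e3 := congrArg (fun z => ψ (τ z)) e0
      simp only [map_mul, map_add, hφψ, hψτ] at e1 e2 e3
      by_cases hc : ψ (τ (algebraMap (RInt p F) F ζ)) = ψ (algebraMap (RInt p F) F ζ)
      · exfalso
        have := aux_ext p K F ζ hζ (ψ.comp (τ : F →ₐ[K] F)) ψ hc
        exact hdisj ψ hψ (by rw [this]; exact hψ)
      · have e4 : (φ (algebraMap (RInt p F) F ζ) - ψ (algebraMap (RInt p F) F ζ)) *
            (φ (algebraMap (RInt p F) F ζ) - ψ (τ (algebraMap (RInt p F) F ζ))) = 0 := by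
          apply mul_left_cancel₀ (sub_ne_zero.2 hc)
          generalize φ (algebraMap (RInt p F) F ζ) = u at *
          generalize ψ (algebraMap (RInt p F) F ζ) = v at *
          generalize ψ (τ (algebraMap (RInt p F) F ζ)) = w at *
          linear_combination (w - v) * e1 + (u - w) * e2 + (v - u) * e3
        rcases mul_eq_zero.1 e4 with h5 | h5
        · left
          rw [aux_ext p K F ζ hζ φ ψ (sub_eq_zero.1 h5)]
          exact hψ
        · right
          exact ⟨ψ, hψ, (aux_ext p K F ζ hζ φ (ψ.comp (τ : F →ₐ[K] F)) (sub_eq_zero.1 h5)).symm⟩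
  refine ⟨hpre, ?_⟩
  have hdis : Disjoint A (A.image (fun φ' => φ'.comp (τ : F →ₐ[K] F))) := by
    rw [Finset.disjoint_right]
    intro φ hφ
    obtain ⟨ψ, hψ, rfl⟩ := Finset.mem_image.1 hφ
    exact hdisj ψ hψ
  have hQ : IsEisPoly p K F E ιE (A ∪ A.image (fun φ' => φ'.comp (τ : F →ₐ[K] F))) ζ
      (QA * QAbar) := by
    rw [IsEisPoly, Polynomial.map_mul, Finset.prod_union hdis, hQA, hQAbar]
  have hJ : JIdeal p K F E (RInt p E) QA ζ * JIdeal p K F E (RInt p E) QAbar ζ =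
      JIdeal p K F E (RInt p E) (QA * QAbar) ζ := by
    rw [JIdeal, JIdeal, JIdeal, Ideal.span_singleton_mul_span_singleton, aux_eElt_mul]
  rw [hJ]
  apply le_antisymm
  · intro x hx
    rw [aux_mem_J p K F E ιE _ ζ hζ _ hQ] at hx
    obtain ⟨a, b, rfl⟩ := aux_gen_tensor p K F E F₀ τ hτ2 hτfix' ζ hζ x
    have hz : ∀ φ : F →ₐ[K] AlgebraicClosure K, phiComponent p K F E ιE φ
        (ζ ⊗ₜ[RInt p K] (1 : RInt p E)) = φ (algebraMap (RInt p F) F ζ) := by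
      intro φ
      rw [phiComponent, Algebra.TensorProduct.productMap_apply_tmul, map_one, mul_one]
      rfl
    have hab : ∀ ψ ∈ A.image (fun φ => φ.comp (IsScalarTower.toAlgHom K F₀ F)),
        phiComponent p K F₀ E ιE ψ a = 0 ∧ phiComponent p K F₀ E ιE ψ b = 0 := by
      intro ψ hψ
      obtain ⟨φ, hφ, rfl⟩ := Finset.mem_image.1 hψ
      have h1 := hx φ (Finset.mem_union_left _ hφ)
      have h2 := hx (φ.comp (τ : F →ₐ[K] F))
        (Finset.mem_union_right _ (Finset.mem_image.2 ⟨φ, hφ, rfl⟩))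
      rw [map_add, map_mul, aux_comp_map, aux_comp_map, hz] at h1 h2
      rw [hres] at h2
      have hne : φ (algebraMap (RInt p F) F ζ) -
          (φ.comp (τ : F →ₐ[K] F)) (algebraMap (RInt p F) F ζ) ≠ 0 := by
        intro h0
        have := aux_ext p K F ζ hζ φ _ (sub_eq_zero.1 h0)
        exact hdisj φ hφ (this ▸ hφ)
      have hb : phiComponent p K F₀ E ιE (φ.comp (IsScalarTower.toAlgHom K F₀ F)) b = 0 := by
        apply mul_left_cancel₀ hne
        linear_combination h1 - h2
      refine ⟨?_, hb⟩
      rw [hb, mul_zero, add_zero] at h1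
      exact h1
    refine Ideal.add_mem _ (Ideal.mem_map_of_mem _ ?_)
      (Ideal.mul_mem_left _ _ (Ideal.mem_map_of_mem _ ?_))
    · exact (aux_mem_J p K F₀ E ιE _ ζ₀ hζ₀ _ hQ₀ a).2 fun ψ hψ => (hab ψ hψ).1
    · exact (aux_mem_J p K F₀ E ιE _ ζ₀ hζ₀ _ hQ₀ b).2 fun ψ hψ => (hab ψ hψ).2
  · rw [Ideal.map_le_iff_le_comap]
    intro a ha
    rw [aux_mem_J p K F₀ E ιE _ ζ₀ hζ₀ _ hQ₀] at ha
    rw [Ideal.mem_comap]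
    refine (aux_mem_J p K F E ιE _ ζ hζ _ hQ _).2 fun φ hφ => ?_
    have h3 := aux_comp_map p K F E ιE F₀ φ a
    exact h3.trans (ha _ ((hpre φ).1 hφ))


end Eis

end
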